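/- arXiv:1910.04230 — 3 statements merged into one kernel-verified Lean document; each statement's English description precedes it below -/
import Mathlib

section
/- Ping-pong lemma for right-angled Coxeter groups: Let G be a group acting on a set X, let Γ be a simple graph on a vertex type V, and let r : V → G be a family of elements of order two (r_v ≠ 1 and r_v² = 1 for every v). Assume that the set {r_v | v ∈ V} generates G and that r_u and r_v commute whenever u and v are adjacent in Γ. Assume moreover that there are subsets X_v ⊆ X for v ∈ V and a point x₀ ∈ X with x₀ ∉ ⋃_v X_v such that: (1) if u and v are adjacent in Γ then r_u • X_v ⊆ X_v; (2) if u and v are distinct and not adjacent in Γ then r_v • X_u ⊆ X_v; (3) r_u • x₀ ∈ X_u for every u ∈ V. Then there exists a group isomorphism φ : C(Γ) ≃ G sending the canonical generator corresponding to each vertex u to r_u. -/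
/-- The defining relations of the right-angled Coxeter group of a simple graph:
squares of the generators, and squares of products of generators corresponding to
adjacent vertices. -/
def racgRels {V : Type*} (G : SimpleGraph V) : Set (FreeGroup V) :=
  {r | (∃ v : V, r = FreeGroup.of v * FreeGroup.of v) ∨
    ∃ u v : V, G.Adj u v ∧ r = (FreeGroup.of u * FreeGroup.of v) ^ 2}

/-- The right-angled Coxeter group of a simple graph. -/
abbrev RACG {V : Type*} (G : SimpleGraph V) : Type _ := PresentedGroup (racgRels G)

/-- The canonical generator of the right-angled Coxeter group corresponding to a vertex. -/
def racgGen {V : Type*} (G : SimpleGraph V) (v : V) : RACG G := PresentedGroup.of v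

/-- A reflection of a right-angled Coxeter group: a conjugate of a canonical generator. -/
def IsReflection {V : Type*} (G : SimpleGraph V) (x : RACG G) : Prop :=
  ∃ (g : RACG G) (v : V), x = g * racgGen G v * g⁻¹

/-- Word length on a right-angled Coxeter group with respect to the canonical generators
(the generators are involutions, so words in the generators suffice). -/
noncomputable def racgLen {V : Type*} (G : SimpleGraph V) (x : RACG G) : ℕ :=
  sInf {n | ∃ l : List V, l.length = n ∧ (l.map (racgGen G)).prod = x}

/-- A word in the vertices is reduced if no shorter word represents the same element. -/
def IsReducedWord {V : Type*} (Γ : SimpleGraph V) (l : List V) : Prop :=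
  ∀ l' : List V, (l'.map (racgGen Γ)).prod = (l.map (racgGen Γ)).prod → l.length ≤ l'.length

theorem racgGen_mul_self {V : Type*} (Γ : SimpleGraph V) (v : V) :
    racgGen Γ v * racgGen Γ v = 1 :=
  PresentedGroup.one_of_mem (rels := racgRels Γ) (Or.inl ⟨v, rfl⟩)

theorem racgGen_inv {V : Type*} (Γ : SimpleGraph V) (v : V) :
    (racgGen Γ v)⁻¹ = racgGen Γ v :=
  inv_eq_of_mul_eq_one_left (racgGen_mul_self Γ v)

theorem racgGen_mul_comm {V : Type*} (Γ : SimpleGraph V) {u v : V} (h : Γ.Adj u v) :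
    racgGen Γ u * racgGen Γ v = racgGen Γ v * racgGen Γ u := by
  have h2 : (racgGen Γ u * racgGen Γ v) ^ 2 = 1 :=
    PresentedGroup.one_of_mem (rels := racgRels Γ) (Or.inr ⟨u, v, h, rfl⟩)
  rw [sq] at h2
  rw [← inv_eq_of_mul_eq_one_left h2, mul_inv_rev, racgGen_inv, racgGen_inv]

theorem exists_word_prod_eq {V : Type*} (Γ : SimpleGraph V) (x : RACG Γ) :
    ∃ l : List V, (l.map (racgGen Γ)).prod = x := by
  have hx : x ∈ Subgroup.closure (Set.range (racgGen Γ)) := by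
    have h := PresentedGroup.closure_range_of (racgRels Γ)
    exact h ▸ Subgroup.mem_top x
  induction hx using Subgroup.closure_induction with
  | mem x hx =>
    obtain ⟨v, rfl⟩ := hx
    exact ⟨[v], by simp⟩
  | one => exact ⟨[], rfl⟩
  | mul x y _ _ hx hy =>
    obtain ⟨l, rfl⟩ := hx
    obtain ⟨m, rfl⟩ := hy
    exact ⟨l ++ m, by simp⟩
  | inv x _ hx =>
    obtain ⟨l, rfl⟩ := hx
    refine ⟨l.reverse, ?_⟩
    rw [List.prod_inv_reverse, List.map_map, List.map_reverse]
    congr 2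
    exact List.map_congr_left fun v _ => (racgGen_inv Γ v).symm

theorem exists_isReducedWord {V : Type*} (Γ : SimpleGraph V) (x : RACG Γ) :
    ∃ l : List V, IsReducedWord Γ l ∧ (l.map (racgGen Γ)).prod = x := by
  obtain ⟨l, hl, hmin⟩ := WellFounded.has_min (measure (List.length (α := V))).wf
    {l : List V | (l.map (racgGen Γ)).prod = x} (exists_word_prod_eq Γ x)
  exact ⟨l, fun l' h => not_lt.mp (hmin l' (h.trans hl)), hl⟩

theorem IsReducedWord.of_cons {V : Type*} {Γ : SimpleGraph V} {v : V} {l : List V}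
    (h : IsReducedWord Γ (v :: l)) : IsReducedWord Γ l := fun l' hl' => by
  simpa using h (v :: l') (by simp [hl'])

theorem IsReducedWord.ne {V : Type*} {Γ : SimpleGraph V} {u v : V} {l : List V}
    (h : IsReducedWord Γ (v :: u :: l)) : u ≠ v := by
  rintro rfl
  have := h l (by simp [← mul_assoc, racgGen_mul_self])
  simp only [List.length_cons] at this
  omega

theorem IsReducedWord.swap {V : Type*} {Γ : SimpleGraph V} {u v : V} {l : List V}
    (h : IsReducedWord Γ (v :: u :: l)) (huv : Γ.Adj u v) : IsReducedWord Γ (u :: v :: l) := by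
  intro l' hl'
  refine h l' (hl'.trans ?_)
  simp [← mul_assoc, racgGen_mul_comm Γ huv]

/-- In a ping-pong configuration, a reduced word starting with `v` sends the base point
into the set attached to `v`. -/
theorem IsReducedWord.smul_mem {V X G : Type*} [Group G] [MulAction G X]
    {Γ : SimpleGraph V} {r : V → G}
    (hcomm : ∀ u v : V, Γ.Adj u v → Commute (r u) (r v))
    {Xs : V → Set X} {x₀ : X}
    (h1 : ∀ u v : V, Γ.Adj u v → ∀ x ∈ Xs v, r u • x ∈ Xs v)
    (h2 : ∀ u v : V, u ≠ v → ¬ Γ.Adj u v → ∀ x ∈ Xs u, r v • x ∈ Xs v)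
    (h3 : ∀ u : V, r u • x₀ ∈ Xs u) (v : V) (l : List V) (h : IsReducedWord Γ (v :: l)) :
    ((v :: l).map r).prod • x₀ ∈ Xs v := by
  induction l generalizing v with
  | nil => simpa using h3 v
  | cons u l ih =>
    by_cases huv : Γ.Adj u v
    · have hmem := h1 u v huv _ (ih v (h.swap huv).of_cons)
      simpa only [List.map_cons, List.prod_cons, smul_smul, ← mul_assoc,
        (hcomm u v huv).eq] using hmem
    · have hmem := h2 u v h.ne huv _ (ih u h.of_cons)
      simpa only [List.map_cons, List.prod_cons, smul_smul] using hmem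

theorem racg_ping_pong {V X G : Type*} [Group G] [MulAction G X]
    (Γ : SimpleGraph V) (r : V → G)
    (hne : ∀ v : V, r v ≠ 1) (hsq : ∀ v : V, r v ^ 2 = 1)
    (hgen : Subgroup.closure (Set.range r) = ⊤)
    (hcomm : ∀ u v : V, Γ.Adj u v → Commute (r u) (r v))
    (Xs : V → Set X) (x₀ : X) (hx₀ : x₀ ∉ ⋃ v : V, Xs v)
    (h1 : ∀ u v : V, Γ.Adj u v → ∀ x ∈ Xs v, r u • x ∈ Xs v)
    (h2 : ∀ u v : V, u ≠ v → ¬ Γ.Adj u v → ∀ x ∈ Xs u, r v • x ∈ Xs v)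
    (h3 : ∀ u : V, r u • x₀ ∈ Xs u) :
    ∃ φ : RACG Γ ≃* G, ∀ u : V, φ (racgGen Γ u) = r u := by
  have hrel : ∀ x ∈ racgRels Γ, FreeGroup.lift r x = 1 := by
    rintro x (⟨v, rfl⟩ | ⟨u, v, huv, rfl⟩)
    · simpa [sq] using hsq v
    · simp [(hcomm u v huv).mul_pow, hsq]
  let f : RACG Γ →* G := PresentedGroup.toGroup hrel
  have hf : ∀ v, f (racgGen Γ v) = r v := fun v => PresentedGroup.toGroup.of hrel
  have hinj : Function.Injective f := by
    rw [injective_iff_map_eq_one]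
    intro x hx
    obtain ⟨l, hl, rfl⟩ := exists_isReducedWord Γ x
    cases l with
    | nil => rfl
    | cons v l =>
      have hmem := hl.smul_mem hcomm h1 h2 h3
      have hprod : ((v :: l).map r).prod = 1 := by
        rw [← hx, map_list_prod, List.map_map]
        congr 1
        exact List.map_congr_left fun w _ => (hf w).symm
      rw [hprod, one_smul] at hmem
      exact absurd (Set.mem_iUnion_of_mem v hmem) hx₀
  have hsurj : Function.Surjective f := by
    rw [← MonoidHom.range_eq_top, eq_top_iff, ← hgen, Subgroup.closure_le]
    rintro _ ⟨v, rfl⟩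
    exact ⟨racgGen Γ v, hf v⟩
  exact ⟨MulEquiv.ofBijective f ⟨hinj, hsurj⟩, hf⟩
end

section
/- Let p, q ≥ 5 be integers and let C_p and C_q denote the cycle graphs with p and q vertices respectively. If q − 4 divides p − 4, then there exists an injective group homomorphism from C(C_p) to C(C_q). -/
/-! A right-angled `(d * m + 4)`-gon is tiled by a chain of `d` right-angled `(m + 4)`-gons. In the
big polygon the sides `0, …, d * m` form the top, and `d * m + 1`, `d * m + 2`, `d * m + 3` are the
right end, the bottom and the left end. Tiles are labelled likewise, those of odd index being
mirror images. -/

namespace PolygonChain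

/-- The side of tile `i` facing tile `i + 1`. -/
def rightSide (m i : ℕ) : ℕ := if i % 2 = 0 then m + 1 else m + 3

/-- The side of tile `i` facing tile `i - 1`. -/
def leftSide (m i : ℕ) : ℕ := if i % 2 = 0 then m + 3 else m + 1

/-- The tile of the chain reached from tile `i` by crossing side `v`, or `i` if that side lies on
the boundary of the chain. -/
def cross (m d v i : ℕ) : ℕ :=
  if v = rightSide m i ∧ i + 1 < d then i + 1
  else if v = leftSide m i ∧ 0 < i ∧ i < d then i - 1 else i

/-- The side of the chain containing side `v` of tile `i`, or `d * m + 4` if there is none. -/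
def label (m d v i : ℕ) : ℕ :=
  if d ≤ i then d * m + 4
  else if v ≤ m then (if i % 2 = 0 then i * m + v else i * m + (m - v))
  else if v = m + 2 then d * m + 2
  else if v = rightSide m i then (if i + 1 = d then d * m + 1 else d * m + 4)
  else if i = 0 then d * m + 3 else d * m + 4

/-- Consecutive vertices of the cycle on `0, …, n - 1`, in one of the two orders. -/
def Next (n u v : ℕ) : Prop := (u + 1 = v ∧ v < n) ∨ (u = 0 ∧ v + 1 = n)

theorem cross_cross (m d v i : ℕ) : cross m d v (cross m d v i) = i := by
  unfold cross rightSide leftSide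
  grind

theorem cross_comm {m d u v : ℕ} (h : Next (m + 4) u v) (i : ℕ) :
    cross m d u (cross m d v i) = cross m d v (cross m d u i) := by
  unfold Next at h
  unfold cross rightSide leftSide
  grind

theorem cross_cases (m d v i : ℕ) : cross m d v i = i ∨
    (v = rightSide m i ∧ i + 1 < d ∧ cross m d v i = i + 1) ∨
    ∃ j, i = j + 1 ∧ v = rightSide m j ∧ j + 1 < d ∧ cross m d v i = j := by
  rcases i with _ | i
  · unfold cross rightSide leftSide
    grind
  · unfold cross rightSide leftSide
    grind

theorem label_succ {m d u i : ℕ} (hi : i + 1 < d)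
    (h : u = rightSide m i ∨ Next (m + 4) u (rightSide m i) ∨ Next (m + 4) (rightSide m i) u) :
    label m d u (i + 1) = label m d u i := by
  have := Nat.succ_mul i m
  unfold Next rightSide at h
  unfold label rightSide
  grind

theorem label_cross {m d u v : ℕ}
    (h : u = v ∨ Next (m + 4) u v ∨ Next (m + 4) v u) (i : ℕ) :
    label m d u (cross m d v i) = label m d u i := by
  obtain h1 | ⟨rfl, hi, h1⟩ | ⟨j, rfl, rfl, hi, h1⟩ := cross_cases m d v i
  · rw [h1]
  · rw [h1, label_succ hi h]
  · rw [h1, label_succ hi h]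

theorem label_adj {m d u v : ℕ} (h : Next (m + 4) u v) (i : ℕ) :
    label m d u i = d * m + 4 ∨ label m d v i = d * m + 4 ∨
    Next (d * m + 4) (label m d u i) (label m d v i) ∨
    Next (d * m + 4) (label m d v i) (label m d u i) := by
  rcases le_or_gt d i with hi | hi
  · simp [label, hi]
  have h1 : i * m + m ≤ d * m := by
    rw [← Nat.succ_mul]; exact Nat.mul_le_mul_right m hi
  have h2 : i + 1 = d → i * m + m = d * m := by
    rintro rfl; rw [Nat.succ_mul]
  have h3 : i = 0 → i * m = 0 := by rintro rfl; simp
  generalize hx : i * m = x at *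
  generalize hy : d * m = y at *
  unfold Next at h ⊢
  unfold label rightSide
  rw [hx, hy]
  grind

/-- Every side of the chain is a side of some tile, and consecutive sides meet at a corner of some
tile. -/
theorem exists_label {m d a b : ℕ} (hm : 0 < m) (hd : 0 < d) (h : Next (d * m + 4) a b) :
    ∃ i u v, i < d ∧ u < m + 4 ∧ v < m + 4 ∧ (Next (m + 4) u v ∨ Next (m + 4) v u) ∧
      label m d u i = a ∧ label m d v i = b := by
  obtain ⟨e, rfl⟩ : ∃ e, d = e + 1 := ⟨d - 1, by omega⟩
  have h2 : (e + 1) * m = e * m + m := Nat.succ_mul e m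
  rcases lt_or_ge a ((e + 1) * m) with ha | ha
  · rcases eq_or_ne b (a + 1) with rfl | hb
    · have hi : a / m < e + 1 := Nat.div_lt_of_lt_mul (by rwa [mul_comm] at ha)
      have hk := Nat.mod_lt a hm
      have hak : a / m * m + a % m = a := Nat.div_add_mod' a m
      generalize a / m = i at *
      generalize a % m = k at *
      rcases Nat.mod_two_eq_zero_or_one i with h0 | h0
      · refine ⟨i, k, k + 1, hi, by omega, by omega, by unfold Next; omega, ?_, ?_⟩ <;>
          · unfold label; grind
      · refine ⟨i, m - k, m - k - 1, hi, by omega, by omega, by unfold Next; omega, ?_, ?_⟩ <;>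
          · unfold label; grind
    · refine ⟨0, 0, m + 3, by omega, by omega, by omega, by unfold Next; omega, ?_, ?_⟩ <;>
        · unfold Next at h; unfold label rightSide; grind
  · have : a = (e + 1) * m ∨ a = (e + 1) * m + 1 ∨ a = (e + 1) * m + 2 := by
      unfold Next at h; omega
    have hb : b = a + 1 := by
      have := Nat.mul_pos hd hm
      unfold Next at h; omega
    subst hb
    rcases this with rfl | rfl | rfl
    · rcases Nat.mod_two_eq_zero_or_one e with h0 | h0
      · refine ⟨e, m, m + 1, by omega, by omega, by omega, by unfold Next; omega, ?_, ?_⟩ <;>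
          · unfold label rightSide; grind
      · refine ⟨e, 0, m + 3, by omega, by omega, by omega, by unfold Next; omega, ?_, ?_⟩ <;>
          · unfold label rightSide; grind
    · rcases Nat.mod_two_eq_zero_or_one e with h0 | h0
      · refine ⟨e, m + 1, m + 2, by omega, by omega, by omega, by unfold Next; omega, ?_, ?_⟩ <;>
          · unfold label rightSide; grind
      · refine ⟨e, m + 3, m + 2, by omega, by omega, by omega, by unfold Next; omega, ?_, ?_⟩ <;>
          · unfold label rightSide; grind
    · refine ⟨0, m + 2, m + 3, by omega, by omega, by omega, by unfold Next; omega, ?_, ?_⟩ <;>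
        · unfold label rightSide; grind

theorem cross_eq_self_of_label {m d v i : ℕ} (h : label m d v i < d * m + 4) :
    cross m d v i = i := by
  unfold label rightSide at h
  unfold cross rightSide leftSide
  grind

theorem label_eq_label {m d u v i j : ℕ} (hm : 0 < m) (hij : i ≤ j) (hj : j < d)
    (hu : u < m + 4) (hv : v < m + 4) (h : label m d u i = label m d v j)
    (hlt : label m d u i < d * m + 4) :
    u = v ∧ (i = j ∨ u = m + 2 ∨
      j = i + 1 ∧ (Next (m + 4) u (rightSide m i) ∨ Next (m + 4) (rightSide m i) u)) := by
  have h1 : j * m + m ≤ d * m := by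
    rw [← Nat.succ_mul]; exact Nat.mul_le_mul_right m hj
  have h2 : i + 1 ≤ j → i * m + m ≤ j * m := by
    intro h; rw [← Nat.succ_mul]; exact Nat.mul_le_mul_right m h
  have h3 : i + 2 ≤ j → i * m + 2 * m ≤ j * m := by
    intro h; rw [← Nat.add_mul]; exact Nat.mul_le_mul_right m h
  have h4 : i = j → i * m = j * m := by rintro rfl; rfl
  generalize hx : i * m = x at *
  generalize hy : d * m = y at *
  generalize hz : j * m = z at *
  unfold label rightSide at h hlt
  unfold Next rightSide
  rw [hx, hy] at h hlt
  rw [hz] at h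
  have h5 : i = j ∨ i + 1 = j ∨ i + 2 ≤ j := by omega
  rcases h5 with h5 | h5 | h5
  · grind
  · grind
  · grind

section Group

variable {G : Type*} [Group G]

/-- A family of elements of a group satisfying the relations of the reflections in the sides
`0, …, n - 1` of a right-angled `n`-gon. -/
structure IsPolygonal (n : ℕ) (t : ℕ → G) : Prop where
  mul_self : ∀ a, t a * t a = 1
  commute : ∀ {a b}, Next n a b → Commute (t a) (t b)

/-- The element carrying tile `0` to tile `i`. -/
def path (m : ℕ) (t : ℕ → G) : ℕ → G
  | 0 => 1
  | i + 1 => path m t i * t (rightSide m i)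

/-- The reflection in side `v` of tile `i`. -/
def tileReflection (m : ℕ) (t : ℕ → G) (i v : ℕ) : G := path m t i * t v * (path m t i)⁻¹

theorem tileReflection_mul_self {m : ℕ} {t : ℕ → G} (ht : IsPolygonal (m + 4) t) (i v : ℕ) :
    tileReflection m t i v * tileReflection m t i v = 1 := by
  simp [tileReflection, mul_assoc, ← mul_assoc (t v) (t v), ht.mul_self]

theorem tileReflection_commute {m : ℕ} {t : ℕ → G} (ht : IsPolygonal (m + 4) t) (i : ℕ) {u v : ℕ}
    (h : Next (m + 4) u v ∨ Next (m + 4) v u) :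
    Commute (tileReflection m t i u) (tileReflection m t i v) := by
  have : Commute (t u) (t v) := h.elim (fun h => ht.commute h) (fun h => (ht.commute h).symm)
  exact this.map (MulAut.conj (path m t i)).toMonoidHom

theorem tileReflection_succ {m : ℕ} {t : ℕ → G} (ht : IsPolygonal (m + 4) t) {i u : ℕ}
    (h : Next (m + 4) u (rightSide m i) ∨ Next (m + 4) (rightSide m i) u) :
    tileReflection m t (i + 1) u = tileReflection m t i u := by
  have : Commute (t (rightSide m i)) (t u) :=
    h.elim (fun h => (ht.commute h).symm) (fun h => ht.commute h)
  simp only [tileReflection, path, mul_inv_rev, mul_assoc]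
  rw [← mul_assoc (t (rightSide m i)), this.eq]
  simp [mul_assoc]

theorem tileReflection_bottom {m : ℕ} {t : ℕ → G} (ht : IsPolygonal (m + 4) t) (i : ℕ) :
    tileReflection m t i (m + 2) = t (m + 2) := by
  induction i with
  | zero => simp [tileReflection, path]
  | succ i ih =>
    rw [tileReflection_succ ht, ih]
    unfold Next rightSide
    grind

theorem tileReflection_eq_of_label_eq {m d u v i j : ℕ} {t : ℕ → G} (ht : IsPolygonal (m + 4) t)
    (hm : 0 < m) (hi : i < d) (hj : j < d) (hu : u < m + 4) (hv : v < m + 4)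
    (h : label m d u i = label m d v j) (hlt : label m d u i < d * m + 4) :
    tileReflection m t i u = tileReflection m t j v := by
  wlog hij : i ≤ j generalizing i j u v
  · exact (this hj hi hv hu h.symm (h ▸ hlt) (by omega)).symm
  obtain ⟨rfl, rfl | rfl | ⟨rfl, h1⟩⟩ := label_eq_label hm hij hj hu hv h hlt
  · rfl
  · rw [tileReflection_bottom ht, tileReflection_bottom ht]
  · exact (tileReflection_succ ht h1).symm

/-- The reflections in the sides of the tiles generate reflections in the sides of the chain. -/
theorem exists_isPolygonal {m d : ℕ} {t : ℕ → G} (ht : IsPolygonal (m + 4) t) (hm : 0 < m)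
    (hd : 0 < d) :
    ∃ s : ℕ → G, IsPolygonal (d * m + 4) s ∧
      ∀ a < d * m + 4, ∃ i < d, ∃ v < m + 4, label m d v i = a ∧ s a = tileReflection m t i v := by
  have hex (a : ℕ) (ha : a < d * m + 4) : ∃ i v, i < d ∧ v < m + 4 ∧ label m d v i = a := by
    rcases a with _ | a
    · obtain ⟨i, u, v, hi, hu, -, -, h, -⟩ :=
        exists_label hm hd (a := 0) (b := 1) (by unfold Next; omega)
      exact ⟨i, u, hi, hu, h⟩
    · obtain ⟨i, u, v, hi, -, hv, -, -, h⟩ :=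
        exists_label hm hd (a := a) (b := a + 1) (by unfold Next; omega)
      exact ⟨i, v, hi, hv, h⟩
  choose! i v hi hv hl using hex
  have key {a j u : ℕ} (ha : a < d * m + 4) (hj : j < d) (hu : u < m + 4)
      (h : label m d u j = a) : tileReflection m t (i a) (v a) = tileReflection m t j u :=
    tileReflection_eq_of_label_eq ht hm (hi a ha) hj (hv a ha) hu ((hl a ha).trans h.symm)
      ((hl a ha).symm ▸ ha)
  refine ⟨fun a => tileReflection m t (i a) (v a),
    ⟨fun a => tileReflection_mul_self ht _ _, fun {a b} hab => ?_⟩,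
    fun a ha => ⟨i a, hi a ha, v a, hv a ha, hl a ha, rfl⟩⟩
  obtain ⟨j, x, y, hj, hx, hy, hxy, hxa, hyb⟩ := exists_label hm hd hab
  have hab' : a < d * m + 4 ∧ b < d * m + 4 := by unfold Next at hab; omega
  simp only [key hab'.1 hj hx hxa, key hab'.2 hj hy hyb]
  exact tileReflection_commute ht j hxy

/-- The action of the reflection in side `v` of a tile on the tiles of the whole tessellation:
`(g, i)` stands for the translate by `g` of the `i`-th tile of the chain. -/
def crossPerm (m d : ℕ) {s : ℕ → G} (hs : ∀ a, s a * s a = 1) (v : ℕ) : Equiv.Perm (G × ℕ) :=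
  Function.Involutive.toPerm (fun x => (s (label m d v x.2) * x.1, cross m d v x.2)) fun x => by
    simp [label_cross (Or.inl rfl), cross_cross, ← mul_assoc, hs]

theorem crossPerm_apply (m d : ℕ) {s : ℕ → G} (hs : ∀ a, s a * s a = 1) (v : ℕ) (x : G × ℕ) :
    crossPerm m d hs v x = (s (label m d v x.2) * x.1, cross m d v x.2) := rfl

theorem isPolygonal_crossPerm {m d : ℕ} {s : ℕ → G} (hs : IsPolygonal (d * m + 4) s)
    (h1 : s (d * m + 4) = 1) : IsPolygonal (m + 4) (crossPerm m d hs.mul_self) where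
  mul_self v := by
    ext x <;> simp [crossPerm_apply, label_cross (Or.inl rfl), cross_cross, ← mul_assoc,
      hs.mul_self]
  commute {u v} h := by
    have hc (i : ℕ) : Commute (s (label m d u i)) (s (label m d v i)) := by
      obtain h2 | h2 | h2 | h2 := label_adj (d := d) h i
      · simp [h2, h1]
      · simp [h2, h1]
      · exact hs.commute h2
      · exact (hs.commute h2).symm
    refine Equiv.ext fun x => ?_
    simp only [Equiv.Perm.mul_apply, crossPerm_apply, label_cross (Or.inr (Or.inl h)),
      label_cross (Or.inr (Or.inr h)), cross_comm h, ← mul_assoc, (hc x.2).eq]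

theorem path_crossPerm_apply {m d : ℕ} {s : ℕ → G} (hs : IsPolygonal (d * m + 4) s)
    (h1 : s (d * m + 4) = 1) {i : ℕ} (hi : i < d) (g : G) :
    path m (crossPerm m d hs.mul_self) i (g, i) = (g, 0) := by
  induction i with
  | zero => rfl
  | succ i ih =>
    have hl : label m d (rightSide m i) (i + 1) = d * m + 4 := by
      unfold label rightSide; grind
    have hc : cross m d (rightSide m i) (i + 1) = i := by
      unfold cross rightSide leftSide; grind
    simp [path, crossPerm_apply, hl, hc, h1, ih (by omega : i < d)]

theorem tileReflection_crossPerm_apply {m d : ℕ} {s : ℕ → G} (hs : IsPolygonal (d * m + 4) s)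
    (h1 : s (d * m + 4) = 1) {i v : ℕ} (hi : i < d) (h : label m d v i < d * m + 4) (g : G) :
    tileReflection m (crossPerm m d hs.mul_self) i v (g, 0) = (s (label m d v i) * g, 0) := by
  have hp := path_crossPerm_apply hs h1 hi
  rw [tileReflection, Equiv.Perm.mul_apply, Equiv.Perm.mul_apply,
    Equiv.Perm.inv_eq_iff_eq.2 (hp g).symm, crossPerm_apply, cross_eq_self_of_label h, hp]

theorem map_tileReflection {K : Type*} [Group K] (f : G →* K) (m : ℕ) (t : ℕ → G) (i v : ℕ) :
    f (tileReflection m t i v) = tileReflection m (f ∘ t) i v := by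
  have (i : ℕ) : f (path m t i) = path m (f ∘ t) i := by
    induction i with
    | zero => simp [path]
    | succ i ih => simp [path, ih]
  simp [tileReflection, this]

theorem tileReflection_congr {m : ℕ} {t t' : ℕ → G} (h : ∀ a < m + 4, t a = t' a) (i : ℕ) {v : ℕ}
    (hv : v < m + 4) : tileReflection m t i v = tileReflection m t' i v := by
  have (i : ℕ) : path m t i = path m t' i := by
    induction i with
    | zero => rfl
    | succ i ih => rw [path, path, ih, h _ (by unfold rightSide; grind)]
  rw [tileReflection, tileReflection, this, h v hv]

end Group

theorem next_or_next_iff_adj {n : ℕ} (hn : 3 ≤ n) {u v : Fin n} :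
    Next n u v ∨ Next n v u ↔ (SimpleGraph.cycleGraph n).Adj u v := by
  have hu := u.isLt
  have hv := v.isLt
  have hmod (x : ℕ) (hx : x < 2 * n) : x % n = if x < n then x else x - n := by
    split_ifs with h
    · exact Nat.mod_eq_of_lt h
    · rw [Nat.mod_eq_sub_mod (by omega), Nat.mod_eq_of_lt (by omega)]
  rw [SimpleGraph.cycleGraph_adj', Fin.val_sub, Fin.val_sub, hmod _ (by omega), hmod _ (by omega)]
  unfold Next
  grind

theorem racgGen_mul_self {V : Type*} (G : SimpleGraph V) (v : V) :
    racgGen G v * racgGen G v = 1 :=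
  PresentedGroup.one_of_mem (rels := racgRels G) (Or.inl ⟨v, rfl⟩)

theorem racgGen_commute {V : Type*} {G : SimpleGraph V} {u v : V} (h : G.Adj u v) :
    Commute (racgGen G u) (racgGen G v) := by
  have h2 : (racgGen G u * racgGen G v) ^ 2 = 1 :=
    PresentedGroup.one_of_mem (rels := racgRels G) (Or.inr ⟨u, v, h, rfl⟩)
  rw [pow_two, ← eq_inv_iff_mul_eq_one, mul_inv_rev,
    inv_eq_of_mul_eq_one_right (racgGen_mul_self G u),
    inv_eq_of_mul_eq_one_right (racgGen_mul_self G v)] at h2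
  exact h2

/-- The generators of the right-angled Coxeter group of a cycle, extended by `1`. -/
def cycleGen (n a : ℕ) : RACG (SimpleGraph.cycleGraph n) :=
  if h : a < n then racgGen _ ⟨a, h⟩ else 1

theorem isPolygonal_cycleGen {n : ℕ} (hn : 3 ≤ n) : IsPolygonal n (cycleGen n) where
  mul_self a := by
    unfold cycleGen
    split_ifs with h
    · exact racgGen_mul_self _ _
    · simp
  commute {a b} h := by
    have hab : a < n ∧ b < n := by unfold Next at h; omega
    rw [cycleGen, cycleGen, dif_pos hab.1, dif_pos hab.2]
    exact racgGen_commute ((next_or_next_iff_adj hn).1 (Or.inl h))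

theorem exists_lift {n : ℕ} (hn : 3 ≤ n) {G : Type*} [Group G] {t : ℕ → G}
    (ht : IsPolygonal n t) :
    ∃ f : RACG (SimpleGraph.cycleGraph n) →* G, ∀ a < n, f (cycleGen n a) = t a := by
  have h : ∀ r ∈ racgRels (SimpleGraph.cycleGraph n),
      FreeGroup.lift (fun v : Fin n => t v) r = 1 := by
    rintro r (⟨v, rfl⟩ | ⟨u, v, huv, rfl⟩)
    · simp [ht.mul_self]
    · have hc : Commute (t u) (t v) := ((next_or_next_iff_adj hn).2 huv).elim
        (fun h => ht.commute h) (fun h => (ht.commute h).symm)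
      rw [map_pow, map_mul, FreeGroup.lift_apply_of, FreeGroup.lift_apply_of, hc.mul_pow, pow_two,
        pow_two, ht.mul_self, ht.mul_self, one_mul]
  refine ⟨PresentedGroup.toGroup h, fun a ha => ?_⟩
  rw [cycleGen, dif_pos ha]
  exact PresentedGroup.toGroup.of h

theorem exists_injective {m d : ℕ} (hm : 0 < m) (hd : 0 < d) :
    ∃ φ : RACG (SimpleGraph.cycleGraph (d * m + 4)) →* RACG (SimpleGraph.cycleGraph (m + 4)),
      Function.Injective φ := by
  have hs := isPolygonal_cycleGen (n := d * m + 4) (by omega)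
  have h1 : cycleGen (d * m + 4) (d * m + 4) = 1 := by simp [cycleGen]
  obtain ⟨r, hr, hrl⟩ := exists_isPolygonal (isPolygonal_cycleGen (n := m + 4) (by omega)) hm hd
  obtain ⟨φ, hφ⟩ := exists_lift (by omega) hr
  obtain ⟨ψ, hψ⟩ := exists_lift (by omega) (isPolygonal_crossPerm hs h1)
  have key (x : RACG (SimpleGraph.cycleGraph (d * m + 4))) : ∀ g, ψ (φ x) (g, 0) = (x * g, 0) := by
    have hx : x ∈ Subgroup.closure (Set.range PresentedGroup.of) := by
      rw [PresentedGroup.closure_range_of]; trivial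
    induction hx using Subgroup.closure_induction with
    | mem x hx =>
      obtain ⟨⟨a, ha⟩, rfl⟩ := hx
      have hg : cycleGen (d * m + 4) a = PresentedGroup.of ⟨a, ha⟩ := dif_pos ha
      intro g
      obtain ⟨i, hi, v, hv, rfl, hra⟩ := hrl a ha
      rw [← hg, hφ _ ha, hra, map_tileReflection, tileReflection_congr (t := ψ ∘ cycleGen (m + 4)) hψ i hv,
        tileReflection_crossPerm_apply hs h1 hi ha]
    | one => simp
    | mul x y _ _ hx hy => simp [hx, hy, mul_assoc]
    | inv x _ hx =>
      intro g
      rw [map_inv, map_inv, Equiv.Perm.inv_eq_iff_eq, hx, mul_inv_cancel_left]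
  refine ⟨φ, fun x y hxy => ?_⟩
  simpa [hxy, key y] using (key x 1).symm

end PolygonChain

theorem racg_cycle_embeds_of_dvd (p q : ℕ) (hp : 5 ≤ p) (hq : 5 ≤ q)
    (hdvd : (q - 4) ∣ (p - 4)) :
    ∃ φ : RACG (SimpleGraph.cycleGraph p) →* RACG (SimpleGraph.cycleGraph q),
      Function.Injective φ := by
  obtain ⟨m, rfl⟩ : ∃ m, q = m + 4 := ⟨q - 4, by omega⟩
  obtain ⟨d, hd⟩ := hdvd
  obtain rfl : p = d * m + 4 := by
    rw [Nat.add_sub_cancel, mul_comm] at hd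
    omega
  exact PolygonChain.exists_injective (by omega) (Nat.pos_of_ne_zero (by rintro rfl; omega))
end

section
/- Let S_n denote the path graph with n+1 vertices (the segment of length n). Then for every n ≥ 0, there exists an injective group homomorphism from C(S_n) to C(S_3). -/
namespace RACG

variable {V W : Type*} {G : SimpleGraph V} {H : SimpleGraph W} {K : Type*} [Group K]

theorem gen_mul_self (v : V) : racgGen G v * racgGen G v = 1 :=
  PresentedGroup.one_of_mem (rels := racgRels G) (Or.inl ⟨v, rfl⟩)

theorem gen_commute {u v : V} (h : G.Adj u v) : Commute (racgGen G u) (racgGen G v) := by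
  have h2 : (racgGen G u * racgGen G v) ^ 2 = 1 :=
    PresentedGroup.one_of_mem (rels := racgRels G) (Or.inr ⟨u, v, h, rfl⟩)
  rw [sq, mul_eq_one_iff_eq_inv, mul_inv_rev, inv_eq_of_mul_eq_one_left (gen_mul_self u),
    inv_eq_of_mul_eq_one_left (gen_mul_self v)] at h2
  exact h2

/-- The universal property of a right-angled Coxeter group: a family of elements of order at
most two, commuting along the edges of the graph, extends to a homomorphism. -/
def lift (f : V → K) (hf : ∀ v, f v * f v = 1) (hc : ∀ u v, G.Adj u v → Commute (f u) (f v)) :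
    RACG G →* K :=
  PresentedGroup.toGroup (f := f) (by
    rintro r (⟨v, rfl⟩ | ⟨u, v, h, rfl⟩)
    · simpa using hf v
    · simp only [map_pow, map_mul, FreeGroup.lift_apply_of]
      rw [(hc u v h).mul_pow, sq, sq, hf, hf, one_mul])

@[simp]
theorem lift_gen (f : V → K) (hf : ∀ v, f v * f v = 1)
    (hc : ∀ u v, G.Adj u v → Commute (f u) (f v)) (v : V) :
    lift f hf hc (racgGen G v) = f v :=
  PresentedGroup.toGroup.of _

theorem hom_ext {f g : RACG G →* K} (h : ∀ v, f (racgGen G v) = g (racgGen G v)) : f = g :=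
  PresentedGroup.ext h

/-- The homomorphism of right-angled Coxeter groups induced by a graph homomorphism. -/
def map (e : G →g H) : RACG G →* RACG H :=
  lift (fun v => racgGen H (e v)) (fun _ => gen_mul_self _)
    (fun _ _ h => gen_commute (e.map_adj h))

@[simp]
theorem map_gen (e : G →g H) (v : V) : map e (racgGen G v) = racgGen H (e v) :=
  lift_gen _ _ _ v

/-- An induced subgraph generates a retract: the retraction kills all the other vertices. -/
theorem map_injective (e : G ↪g H) : Function.Injective (map e.toHom) := by
  classical
  let r : W → RACG G := fun w => if h : ∃ v, e v = w then racgGen G h.choose else 1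
  have hr (v : V) : r (e v) = racgGen G v := by
    have h : ∃ v', e v' = e v := ⟨v, rfl⟩
    simp only [r, dif_pos h]
    rw [e.injective h.choose_spec]
  have hr' (w : W) (hw : ¬ ∃ v, e v = w) : r w = 1 := dif_neg hw
  have hsq (w : W) : r w * r w = 1 := by
    by_cases hw : ∃ v, e v = w
    · obtain ⟨v, rfl⟩ := hw
      rw [hr, gen_mul_self]
    · rw [hr' w hw, one_mul]
  have hcomm (u w : W) (h : H.Adj u w) : Commute (r u) (r w) := by
    by_cases hu : ∃ v, e v = u
    · by_cases hw : ∃ v, e v = w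
      · obtain ⟨u, rfl⟩ := hu
        obtain ⟨w, rfl⟩ := hw
        rw [hr, hr]
        exact gen_commute (e.map_adj_iff.1 h)
      · rw [hr' w hw]
        exact Commute.one_right _
    · rw [hr' u hu]
      exact Commute.one_left _
  have key : (lift r hsq hcomm).comp (map e.toHom) = MonoidHom.id _ :=
    hom_ext fun v => by simp [hr]
  exact Function.LeftInverse.injective (DFunLike.congr_fun key)

/-- The automorphism of a right-angled Coxeter group induced by an involution of the graph. -/
def autOfInvolutive (e : G →g G) (he : Function.Involutive e) : MulAut (RACG G) :=
  MonoidHom.toMulEquiv (map e) (map e) (hom_ext fun v => by simp [he v])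
    (hom_ext fun v => by simp [he v])

@[simp]
theorem autOfInvolutive_gen (e : G →g G) (he : Function.Involutive e) (v : V) :
    autOfInvolutive e he (racgGen G v) = racgGen G (e v) :=
  map_gen e v

theorem autOfInvolutive_mul_self (e : G →g G) (he : Function.Involutive e) :
    autOfInvolutive e he * autOfInvolutive e he = 1 := by
  apply MulEquiv.toMonoidHom_injective
  exact hom_ext fun v => by simp [he v]

open SimpleGraph

/-- The reflection of a path graph. -/
def pathRev (n : ℕ) : pathGraph n →g pathGraph n where
  toFun := Fin.rev
  map_rel' {a b} h := by
    rw [pathGraph_adj] at h ⊢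
    simp only [Fin.val_rev]
    lia

theorem pathRev_involutive (n : ℕ) : Function.Involutive (pathRev n) := Fin.rev_rev

/-- The embedding of a path graph as an initial segment of a longer one. -/
def pathCastLE {m n : ℕ} (h : m ≤ n) : pathGraph m ↪g pathGraph n where
  toEmbedding := Fin.castLEEmb h
  map_rel_iff' := by simp [pathGraph_adj]

/-- The images of the generators of the path with `2 * k + 1` vertices: the path with `k + 1`
vertices obtained by deleting the vertex `0` of the path with `k + 2` vertices, together with its
conjugate by the generator at `0`. -/
def unfoldGen (k : ℕ) (i : Fin (2 * k + 1)) : RACG (pathGraph (k + 2)) :=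
  if h : k ≤ i then racgGen _ ⟨i - k + 1, by lia⟩
  else racgGen _ 0 * racgGen _ ⟨k - i + 1, by lia⟩ * (racgGen _ 0)⁻¹

theorem unfoldGen_of_le {k : ℕ} {i : Fin (2 * k + 1)} (h : k ≤ i) :
    unfoldGen k i = racgGen _ ⟨i - k + 1, by lia⟩ :=
  dif_pos h

theorem unfoldGen_of_ge {k : ℕ} {i : Fin (2 * k + 1)} (h : i ≤ k) :
    unfoldGen k i = racgGen _ 0 * racgGen _ ⟨k - i + 1, by lia⟩ * (racgGen _ 0)⁻¹ := by
  rcases h.lt_or_eq with h | h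
  · exact dif_neg h.not_ge
  · rw [unfoldGen_of_le h.ge, eq_mul_inv_iff_mul_eq]
    have : (⟨i - k + 1, by lia⟩ : Fin (k + 2)) = ⟨k - i + 1, by lia⟩ := by ext; simp [h]
    rw [this]
    exact gen_commute (by simp [pathGraph_adj, h])

/-- The homomorphism from the group of the path with `2 * k + 1` vertices onto the kernel of the
parity of the generator at `0` in the group of the path with `k + 2` vertices. -/
def unfold (k : ℕ) : RACG (pathGraph (2 * k + 1)) →* RACG (pathGraph (k + 2)) :=
  lift (unfoldGen k)
    (fun i => by
      rcases le_total k i with h | h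
      · rw [unfoldGen_of_le h, gen_mul_self]
      · rw [unfoldGen_of_ge h, conj_mul, gen_mul_self, mul_one, mul_inv_cancel])
    (fun i j hij => by
      rw [pathGraph_adj] at hij
      have hcases : (k ≤ i ∧ k ≤ j) ∨ (i ≤ k ∧ j ≤ k) := by lia
      rcases hcases with ⟨hi, hj⟩ | ⟨hi, hj⟩
      · rw [unfoldGen_of_le hi, unfoldGen_of_le hj]
        exact gen_commute (by rw [pathGraph_adj]; dsimp only; lia)
      · rw [unfoldGen_of_ge hi, unfoldGen_of_ge hj, Commute.conj_iff]
        exact gen_commute (by rw [pathGraph_adj]; dsimp only; lia))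

/-- The images of the generators of the path with `k + 2` vertices in the holomorph of the group
of the path with `2 * k + 1` vertices: the vertex `0` acts by the reflection of the path. -/
def foldGen (k : ℕ) (j : Fin (k + 2)) :
    RACG (pathGraph (2 * k + 1)) ⋊[MonoidHom.id _] MulAut (RACG (pathGraph (2 * k + 1))) :=
  if h : j = 0 then SemidirectProduct.inr (autOfInvolutive _ (pathRev_involutive _))
  else SemidirectProduct.inl (racgGen _ ⟨k + j - 1, by lia⟩)

theorem foldGen_zero (k : ℕ) :
    foldGen k 0 = SemidirectProduct.inr (autOfInvolutive _ (pathRev_involutive _)) :=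
  dif_pos rfl

theorem foldGen_of_ne_zero {k : ℕ} {j : Fin (k + 2)} (h : j ≠ 0) :
    foldGen k j = SemidirectProduct.inl (racgGen _ ⟨k + j - 1, by lia⟩) :=
  dif_neg h

theorem foldGen_zero_conj (k : ℕ) (i : Fin (2 * k + 1)) :
    foldGen k 0 * SemidirectProduct.inl (racgGen _ i) * (foldGen k 0)⁻¹ =
      SemidirectProduct.inl (racgGen _ i.rev) := by
  rw [foldGen_zero, ← map_inv, ← SemidirectProduct.inl_aut]
  simp [pathRev]

theorem foldGen_mul_self (k : ℕ) (j : Fin (k + 2)) : foldGen k j * foldGen k j = 1 := by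
  by_cases h : j = 0
  · rw [h, foldGen_zero, ← map_mul, autOfInvolutive_mul_self, map_one]
  · rw [foldGen_of_ne_zero h, ← map_mul, gen_mul_self, map_one]

theorem foldGen_zero_commute {k : ℕ} {j : Fin (k + 2)} (h : (j : ℕ) = 1) :
    Commute (foldGen k 0) (foldGen k j) := by
  have hj : j ≠ 0 := by rintro rfl; simp at h
  rw [foldGen_of_ne_zero hj]
  refine mul_inv_eq_iff_eq_mul.1 ((foldGen_zero_conj k _).trans ?_)
  congr 2
  ext
  simp only [Fin.val_rev]
  lia

theorem foldGen_commute (k : ℕ) (i j : Fin (k + 2)) (hij : (pathGraph (k + 2)).Adj i j) :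
    Commute (foldGen k i) (foldGen k j) := by
  rw [pathGraph_adj] at hij
  by_cases hi : i = 0
  · subst hi
    exact foldGen_zero_commute (by simpa [eq_comm] using hij)
  by_cases hj : j = 0
  · subst hj
    exact (foldGen_zero_commute (by simpa [eq_comm] using hij)).symm
  rw [foldGen_of_ne_zero hi, foldGen_of_ne_zero hj]
  refine (gen_commute ?_).map _
  rw [pathGraph_adj]
  rw [Fin.ext_iff, Fin.val_zero] at hi hj
  dsimp only
  lia

theorem unfold_injective (k : ℕ) : Function.Injective (unfold k) := by
  have key : (lift (foldGen k) (foldGen_mul_self k) (foldGen_commute k)).comp (unfold k) =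
      SemidirectProduct.inl := by
    refine hom_ext fun i => ?_
    rw [MonoidHom.comp_apply, unfold, lift_gen]
    rcases le_total k i with h | h
    · rw [unfoldGen_of_le h, lift_gen, foldGen_of_ne_zero (by simp [Fin.ext_iff])]
      congr 2
      ext
      dsimp only
      lia
    · rw [unfoldGen_of_ge h, map_mul, map_mul, map_inv, lift_gen, lift_gen,
        foldGen_of_ne_zero (j := ⟨k - i + 1, _⟩) (by simp [Fin.ext_iff]), foldGen_zero_conj]
      congr 2
      ext
      simp only [Fin.val_rev]
      lia
  refine Function.Injective.of_comp
    (f := lift (foldGen k) (foldGen_mul_self k) (foldGen_commute k)) ?_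
  rw [← MonoidHom.coe_comp, key]
  exact SemidirectProduct.inl_injective

theorem exists_injective_path_four (m : ℕ) :
    ∃ φ : RACG (pathGraph m) →* RACG (pathGraph 4), Function.Injective φ := by
  induction m with
  | zero => exact ⟨_, map_injective (pathCastLE (Nat.zero_le 4))⟩
  | succ m ih =>
    rcases le_or_gt m 3 with hm | hm
    · exact ⟨_, map_injective (pathCastLE (by lia : m + 1 ≤ 4))⟩
    · obtain ⟨k, rfl⟩ : ∃ k, m = k + 2 := ⟨m - 2, by lia⟩
      obtain ⟨φ, hφ⟩ := ih
      exact ⟨(φ.comp (unfold k)).comp (map (pathCastLE (by lia : k + 2 + 1 ≤ 2 * k + 1)).toHom),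
        (hφ.comp (unfold_injective k)).comp (map_injective _)⟩

end RACG

theorem racg_segment_embeds_in_S3 (n : ℕ) :
    ∃ φ : RACG (SimpleGraph.pathGraph (n + 1)) →* RACG (SimpleGraph.pathGraph 4),
      Function.Injective φ :=
  RACG.exists_injective_path_four (n + 1)
end
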